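/- Let g : ℝ^d → ℝ^d be an affine map, η ≠ 0 a real number, and θ_0, …, θ_K ∈ ℝ^d iterates satisfying θ_{k+1} = θ_k − η g(θ_k) for 0 ≤ k ≤ K−1; let R = [θ_1 − θ_0, …, θ_K − θ_{K−1}]. Then the two constrained optimization problems min ‖g(∑_{k=1}^K c_k θ_{k−1})‖² and min (1/η²)‖R c‖², both over { c ∈ ℝ^K : ∑_{k=1}^K c_k = 1 }, have the same objective values at every feasible c and hence the same sets of minimizers. In other words, in the exact quadratic (affine-gradient) case, the ideal RNA problem (2) of minimizing the squared gradient norm of the affine combination is equivalent to the least-squares problem in the consecutive differences solved by the algorithm (with λ = 0). -/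

import Mathlib

open Matrix

/-- **Equivalence of the ideal RNA problem and the least-squares problem**:
If `g x = A x + b` is affine, `η ≠ 0`, the iterates satisfy
`θ_{k+1} = θ_k − η g(θ_k)`, and `R = [θ_1 − θ_0, …, θ_K − θ_{K−1}]`, then over
the constraint set `{ c : ∑ k, c k = 1 }` the objectives
`c ↦ ‖g(∑ k, c k • θ_{k−1})‖²` and `c ↦ (1/η²) ‖R c‖²` (squared Euclidean
norms) coincide at every feasible point, and hence have the same sets of
minimizers. -/
theorem rna_ideal_problem_equiv_least_squares
    (d K : ℕ) (A : Matrix (Fin d) (Fin d) ℝ) (b : Fin d → ℝ)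
    (g : (Fin d → ℝ) → (Fin d → ℝ)) (hg : ∀ x, g x = A.mulVec x + b)
    (η : ℝ) (hη : η ≠ 0) (θ : Fin (K + 1) → (Fin d → ℝ))
    (hθ : ∀ k : Fin K, θ k.succ = θ k.castSucc - η • g (θ k.castSucc))
    (R : Matrix (Fin d) (Fin K) ℝ)
    (hR : R = Matrix.of fun i k => θ k.succ i - θ k.castSucc i) :
    (∀ c : Fin K → ℝ, ∑ k, c k = 1 →
        (∑ i, (g (∑ k : Fin K, c k • θ k.castSucc) i) ^ 2) =
          (1 / η ^ 2) * ∑ i, (R.mulVec c i) ^ 2) ∧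
      {c : Fin K → ℝ | (∑ k, c k = 1) ∧
          ∀ c' : Fin K → ℝ, ∑ k, c' k = 1 →
            (∑ i, (g (∑ k : Fin K, c k • θ k.castSucc) i) ^ 2) ≤
              ∑ i, (g (∑ k : Fin K, c' k • θ k.castSucc) i) ^ 2} =
        {c : Fin K → ℝ | (∑ k, c k = 1) ∧
          ∀ c' : Fin K → ℝ, ∑ k, c' k = 1 →
            (1 / η ^ 2) * (∑ i, (R.mulVec c i) ^ 2) ≤
              (1 / η ^ 2) * ∑ i, (R.mulVec c' i) ^ 2} := by
  have key : ∀ c : Fin K → ℝ, ∑ k, c k = 1 →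
        (∑ i, (g (∑ k : Fin K, c k • θ k.castSucc) i) ^ 2) =
          (1 / η ^ 2) * ∑ i, (R.mulVec c i) ^ 2 := by
    intro c hc
    have h1 : g (∑ k : Fin K, c k • θ k.castSucc) = ∑ k, c k • g (θ k.castSucc) := by
      simp only [hg, smul_add, Finset.sum_add_distrib, ← Finset.sum_smul, hc, one_smul,
        Matrix.mulVec_sum, Matrix.mulVec_smul]
    have h2 : ∀ i, R.mulVec c i = -η * g (∑ k : Fin K, c k • θ k.castSucc) i := by
      intro i
      rw [h1, hR]
      simp only [Matrix.mulVec, dotProduct, Matrix.of_apply, hθ, Finset.sum_apply, Pi.sub_apply,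
        Pi.smul_apply, smul_eq_mul, Finset.mul_sum]
      refine Finset.sum_congr rfl fun k _ => ?_
      ring
    rw [Finset.mul_sum]
    refine Finset.sum_congr rfl fun i _ => ?_
    rw [h2]
    field_simp
  refine ⟨key, ?_⟩
  ext c
  simp only [Set.mem_setOf_eq]
  refine and_congr_right fun hc => forall_congr' fun c' => forall_congr' fun hc' => ?_
  rw [key c hc, key c' hc']
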